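/- Let η, τ, λ, ω ∈ ℝ and d := η² − τ² − λ², and assume (d, ω) ≠ (−4, 0). Let X ∈ ℝ solve dX² − 4 + (4 + ω² − d)X = 0 and set z := (dX² + 4)/(X(4 + d − ω² + 4ωi)). Then the matrices M^±_{η,τ,λ,ω} and M^±_{Xη,Xτ,Xλ,0} are invertible and (M^+_{η,τ,λ,ω})⁻¹ · M^−_{η,τ,λ,ω} · (M^−_{Xη,Xτ,Xλ,0})⁻¹ · M^+_{Xη,Xτ,Xλ,0} = z̄ · I₂, where z̄ is the complex conjugate of z. -/

import Mathlib

open Matrix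

noncomputable def σ1 : Matrix (Fin 2) (Fin 2) ℂ := !![0, 1; 1, 0]
noncomputable def σ2 : Matrix (Fin 2) (Fin 2) ℂ := !![0, -Complex.I; Complex.I, 0]
noncomputable def σ3 : Matrix (Fin 2) (Fin 2) ℂ := !![1, 0; 0, -1]

/-- `σ · v = v₁ σ₁ + v₂ σ₂` for a real vector `v`. -/
noncomputable def σdot (v : ℝ × ℝ) : Matrix (Fin 2) (Fin 2) ℂ :=
  (v.1 : ℂ) • σ1 + (v.2 : ℂ) • σ2

/-- The tangent vector `t = (−n₂, n₁)` associated with the normal `n`. -/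
def tvec (n : ℝ × ℝ) : ℝ × ℝ := (-n.2, n.1)

/-- The matrix `M^±_{η,τ,λ,ω} = ± i (σ·n) + ½(η I₂ + τ σ₃ + λ (σ·t) + ω (σ·n))`,
where the sign is encoded by `ε ∈ {1, −1}`. -/
noncomputable def Mmat (ε : ℂ) (n : ℝ × ℝ) (η τ l ω : ℝ) : Matrix (Fin 2) (Fin 2) ℂ :=
  ε • (Complex.I • σdot n) +
    (1 / 2 : ℂ) • ((η : ℂ) • (1 : Matrix (Fin 2) (Fin 2) ℂ) + (τ : ℂ) • σ3
      + (l : ℂ) • σdot (tvec n) + (ω : ℂ) • σdot n)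

/-- The product `(σ·n)(η I₂ + τ σ₃ + λ (σ·t))` for a unit vector `n`. -/
noncomputable def Bmat (n : ℝ × ℝ) (η τ l : ℝ) : Matrix (Fin 2) (Fin 2) ℂ :=
  !![Complex.I * l, (n.1 - Complex.I * n.2) * (η - τ);
    (n.1 + Complex.I * n.2) * (η + τ), -(Complex.I * l)]

lemma ofReal_normal {n : ℝ × ℝ} (hn : n.1 ^ 2 + n.2 ^ 2 = 1) :
    (n.1 : ℂ) ^ 2 + (n.2 : ℂ) ^ 2 = 1 := by
  exact_mod_cast congrArg Complex.ofReal hn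

lemma Bmat_mul_self {n : ℝ × ℝ} (hn : n.1 ^ 2 + n.2 ^ 2 = 1) (η τ l : ℝ) :
    Bmat n η τ l * Bmat n η τ l
      = (((η ^ 2 - τ ^ 2 - l ^ 2 : ℝ)) : ℂ) • (1 : Matrix (Fin 2) (Fin 2) ℂ) := by
  have h := ofReal_normal hn
  have hI := Complex.I_sq
  ext i j
  fin_cases i <;> fin_cases j <;>
    simp [Bmat, Matrix.mul_apply, Fin.sum_univ_two] <;> grind

lemma Bmat_smul (n : ℝ × ℝ) (X η τ l : ℝ) :
    Bmat n (X * η) (X * τ) (X * l) = (X : ℂ) • Bmat n η τ l := by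
  ext i j
  fin_cases i <;> fin_cases j <;> simp [Bmat] <;> ring

/-- The adjugate of `M^±_{η,τ,λ,ω}` is `M^∓_{η,-τ,-λ,-ω}`. -/
lemma adjugate_Mmat (ε : ℂ) (n : ℝ × ℝ) (η τ l ω : ℝ) :
    (Mmat ε n η τ l ω).adjugate = Mmat (-ε) n η (-τ) (-l) (-ω) := by
  rw [Matrix.adjugate_fin_two]
  ext i j
  fin_cases i <;> fin_cases j <;> simp [Mmat, σdot, tvec, σ1, σ2, σ3] <;> ring

lemma det_Mmat {n : ℝ × ℝ} (hn : n.1 ^ 2 + n.2 ^ 2 = 1) (ε : ℂ) (η τ l ω : ℝ) :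
    (Mmat ε n η τ l ω).det
      = (((η ^ 2 - τ ^ 2 - l ^ 2 : ℝ) : ℂ) - (ω + 2 * ε * Complex.I) ^ 2) / 4 := by
  have h := ofReal_normal hn
  have hI := Complex.I_sq
  rw [Matrix.det_fin_two]
  simp [Mmat, σdot, tvec, σ1, σ2, σ3]
  grind

lemma adjugate_Mmat_mul {n : ℝ × ℝ} (hn : n.1 ^ 2 + n.2 ^ 2 = 1) {ε : ℂ} (hε : ε ^ 2 = 1)
    (η τ l ω : ℝ) :
    (Mmat ε n η τ l ω).adjugate * Mmat (-ε) n η τ l ω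
      = (((η ^ 2 - τ ^ 2 - l ^ 2 - ω ^ 2 - 4 : ℝ) : ℂ) / 4) • (1 : Matrix (Fin 2) (Fin 2) ℂ)
        - (ε * Complex.I) • Bmat n η τ l := by
  have h := ofReal_normal hn
  have hI := Complex.I_sq
  rw [adjugate_Mmat]
  ext i j
  fin_cases i <;> fin_cases j <;>
    simp [Mmat, Bmat, σdot, tvec, σ1, σ2, σ3, Matrix.mul_apply, Fin.sum_univ_two] <;> grind

theorem stmt_4 (n : ℝ × ℝ) (hn : n.1 ^ 2 + n.2 ^ 2 = 1) (η τ l ω : ℝ)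
    (hne : (η ^ 2 - τ ^ 2 - l ^ 2, ω) ≠ ((-4 : ℝ), (0 : ℝ)))
    (X : ℝ)
    (hsol : (η ^ 2 - τ ^ 2 - l ^ 2) * X ^ 2 - 4
      + (4 + ω ^ 2 - (η ^ 2 - τ ^ 2 - l ^ 2)) * X = 0)
    (z : ℂ)
    (hz : z = (((η ^ 2 - τ ^ 2 - l ^ 2) * X ^ 2 + 4 : ℝ) : ℂ) /
      ((X : ℂ) * (4 + ((η ^ 2 - τ ^ 2 - l ^ 2 : ℝ) : ℂ) - (ω : ℂ) ^ 2
        + 4 * (ω : ℂ) * Complex.I))) :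
    IsUnit (Mmat 1 n η τ l ω) ∧ IsUnit (Mmat (-1) n η τ l ω) ∧
    IsUnit (Mmat 1 n (X * η) (X * τ) (X * l) 0) ∧
    IsUnit (Mmat (-1) n (X * η) (X * τ) (X * l) 0) ∧
    (Mmat 1 n η τ l ω)⁻¹ * Mmat (-1) n η τ l ω
        * (Mmat (-1) n (X * η) (X * τ) (X * l) 0)⁻¹
        * Mmat 1 n (X * η) (X * τ) (X * l) 0
      = (starRingEnd ℂ z) • (1 : Matrix (Fin 2) (Fin 2) ℂ) := by
  set d : ℝ := η ^ 2 - τ ^ 2 - l ^ 2 with hd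
  clear_value d
  have hX : X ≠ 0 := by
    rintro rfl
    norm_num at hsol
  have hXC : (X : ℂ) ≠ 0 := by exact_mod_cast hX
  have hdX : (X * η) ^ 2 - (X * τ) ^ 2 - (X * l) ^ 2 = d * X ^ 2 := by rw [hd]; ring
  have hE : d * X ^ 2 + 4 ≠ 0 := by
    intro h0
    have h1 : 4 * (X - 1) ^ 2 + (ω * X) ^ 2 = 0 := by
      linear_combination X * hsol + (1 - X) * h0
    have h2 : X = 1 := by nlinarith [sq_nonneg (X - 1), sq_nonneg (ω * X)]
    subst h2
    refine hne (Prod.ext ?_ ?_)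
    · linarith
    · simpa using h1
  have hD (s : ℝ) (hs : s ≠ 0) : (4 + d - ω ^ 2 : ℂ) + 4 * s * ω * Complex.I ≠ 0 := by
    intro h0
    have hre := congrArg Complex.re h0
    have him := congrArg Complex.im h0
    simp [← Complex.ofReal_pow] at hre him
    have hω : ω = 0 := by tauto
    subst hω
    exact hne (Prod.ext (by norm_num at hre ⊢; linarith) rfl)
  have hI := Complex.I_sq
  have hdetp : (Mmat 1 n η τ l ω).det = (4 + d - ω ^ 2 - 4 * ω * Complex.I) / 4 := by
    rw [det_Mmat hn, ← hd]; linear_combination -hI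
  have hdetm : (Mmat (-1) n η τ l ω).det = (4 + d - ω ^ 2 + 4 * ω * Complex.I) / 4 := by
    rw [det_Mmat hn, ← hd]; linear_combination -hI
  have hdetX (ε : ℂ) (hε : ε ^ 2 = 1) :
      (Mmat ε n (X * η) (X * τ) (X * l) 0).det = (d * X ^ 2 + 4) / 4 := by
    rw [det_Mmat hn, hdX]; push_cast; linear_combination -hε * Complex.I ^ 2 - hI
  have hEC : (d * X ^ 2 + 4 : ℂ) ≠ 0 := by exact_mod_cast hE
  have hDp : (4 + d - ω ^ 2 - 4 * ω * Complex.I : ℂ) ≠ 0 := by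
    convert hD (-1) (by norm_num) using 1; push_cast; ring
  have hDm : (4 + d - ω ^ 2 + 4 * ω * Complex.I : ℂ) ≠ 0 := by
    convert hD 1 one_ne_zero using 1; push_cast; ring
  have hup : IsUnit (Mmat 1 n η τ l ω).det := by
    rw [hdetp]; exact (div_ne_zero hDp (by norm_num)).isUnit
  have hum : IsUnit (Mmat (-1) n η τ l ω).det := by
    rw [hdetm]; exact (div_ne_zero hDm (by norm_num)).isUnit
  have huX (ε : ℂ) (hε : ε ^ 2 = 1) : IsUnit (Mmat ε n (X * η) (X * τ) (X * l) 0).det := by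
    rw [hdetX ε hε]; exact (div_ne_zero hEC (by norm_num)).isUnit
  simp only [Matrix.isUnit_iff_isUnit_det]
  refine ⟨hup, hum, huX 1 (by norm_num), huX (-1) (by norm_num), ?_⟩
  have hsolC : (d : ℂ) * X ^ 2 - 4 + (4 + ω ^ 2 - d) * X = 0 := by exact_mod_cast hsol
  have hz' : starRingEnd ℂ z
      = (d * X ^ 2 + 4) / (X * (4 + d - ω ^ 2 - 4 * ω * Complex.I)) := by
    rw [hz]
    simp only [map_div₀, map_mul, map_add, map_sub, map_pow, Complex.conj_ofReal, Complex.conj_I,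
      map_ofNat]
    push_cast
    ring
  have hprod : (Mmat 1 n η τ l ω).adjugate * Mmat (-1) n η τ l ω
      * ((Mmat (-1) n (X * η) (X * τ) (X * l) 0).adjugate * Mmat 1 n (X * η) (X * τ) (X * l) 0)
      = ((d * X ^ 2 + 4 : ℂ) ^ 2 / (16 * X)) • (1 : Matrix (Fin 2) (Fin 2) ℂ) := by
    have h1 := adjugate_Mmat_mul hn (ε := 1) (by norm_num) η τ l ω
    have h2 := adjugate_Mmat_mul hn (ε := -1) (by norm_num) (X * η) (X * τ) (X * l) 0
    have hp : (((d - ω ^ 2 - 4 : ℝ) : ℂ) / 4) = (d * X ^ 2 - 4) / (4 * X) := by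
      field_simp
      push_cast
      linear_combination -hsolC
    rw [neg_neg] at h2
    rw [h1, h2, hdX, Bmat_smul, ← hd, hp]
    simp only [sub_mul, mul_sub, smul_mul_smul_comm, one_mul, mul_one, Bmat_mul_self hn, smul_smul]
    rw [← hd]
    match_scalars
    · field_simp
      linear_combination (-256 * X ^ 2 * d) * hI
    · field_simp
      ring
  rw [Matrix.inv_def, Matrix.inv_def, Ring.inverse_eq_inv', hdetp, hdetX (-1) (by norm_num)]
  simp only [Matrix.smul_mul, Matrix.mul_smul, Matrix.mul_assoc] at hprod ⊢
  rw [hprod, hz', smul_smul, smul_smul]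
  congr 1
  field_simp
  norm_num
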